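/- Fix n ≥ 1, a response vector Y ∈ {0,1}ⁿ, and a sequence of priors and design matrices 𝒟_p = (v_p, Q_p, X_{n×p}, Y) for p ≥ 1, where each Q_p is positive definite. Assume (B1) each X_{n×p} has full row rank, and (B2) there exists a finite constant c with λ_max( X_{n×p} Q_p⁻¹ X_{n×p}ᵀ ) < c for all p. Then there exists a constant ρ < 1 such that ρ*(𝒟_p) ≤ ρ for all p, where ρ*(𝒟_p) is the geometric convergence rate of the Albert–Chib chain for 𝒟_p. -/

import Mathlib

open MeasureTheory Matrix Filter

noncomputable section

/-- standard normal pdf -/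
def nphi (x : ℝ) : ℝ := (Real.sqrt (2 * Real.pi))⁻¹ * Real.exp (-(x ^ 2) / 2)

/-- standard normal cdf -/
def nPhi (x : ℝ) : ℝ := ∫ t in Set.Iic x, nphi t

/-- density of TN(θ,1;1) (if b = true) resp. TN(θ,1;0) (if b = false) at z -/
def tn (θ : ℝ) (b : Bool) (z : ℝ) : ℝ :=
  if b then (if 0 < z then nphi (z - θ) / nPhi θ else 0)
  else (if z < 0 then nphi (z - θ) / (1 - nPhi θ) else 0)

/-- p-variate Gaussian density with mean μ and covariance matrix Λ -/
def mvn {p : ℕ} (μ : Fin p → ℝ) (Λ : Matrix (Fin p) (Fin p) ℝ) (x : Fin p → ℝ) : ℝ :=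
  Real.sqrt (((2 * Real.pi) ^ p * Λ.det)⁻¹) *
    Real.exp (-(dotProduct (x - μ) (Λ⁻¹.mulVec (x - μ))) / 2)

/-- squared Euclidean norm -/
def normSq {m : ℕ} (x : Fin m → ℝ) : ℝ := ∑ i, x i ^ 2

/-- Albert and Chib's Markov transition density, with Σ = XᵀX + Q -/
def kAC {n p : ℕ} (X : Matrix (Fin n) (Fin p) ℝ) (Y : Fin n → Bool)
    (v : Fin p → ℝ) (Q : Matrix (Fin p) (Fin p) ℝ) (β β' : Fin p → ℝ) : ℝ :=
  ∫ z : Fin n → ℝ,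
    mvn ((Xᵀ * X + Q)⁻¹.mulVec (Xᵀ.mulVec z + Q.mulVec v)) (Xᵀ * X + Q)⁻¹ β' *
      ∏ i, tn (dotProduct (X i) β) (Y i) (z i)

/-- the defining property of the posterior mode B̂ -/
def IsPosteriorMode {n p : ℕ} (X : Matrix (Fin n) (Fin p) ℝ) (Y : Fin n → Bool)
    (v : Fin p → ℝ) (Q : Matrix (Fin p) (Fin p) ℝ) (Bhat : Fin p → ℝ) : Prop :=
  (∑ i, (if Y i then nphi (dotProduct (X i) Bhat) / nPhi (dotProduct (X i) Bhat)
          else -(nphi (dotProduct (X i) Bhat) / (1 - nPhi (dotProduct (X i) Bhat)))) • X i)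
    - Q.mulVec (Bhat - v) = 0

/-- largest eigenvalue of a symmetric real matrix, as the supremum of the
Rayleigh quotient -/
def lmax {m : ℕ} (M : Matrix (Fin m) (Fin m) ℝ) : ℝ :=
  sSup {r : ℝ | ∃ x : Fin m → ℝ, x ≠ 0 ∧ r = dotProduct x (M.mulVec x) / normSq x}

/-- `kIter k m` is the (m+1)-step transition density associated with a transition
density `k`. -/
def kIter {A : Type*} [MeasureSpace A] (k : A → A → ℝ) : ℕ → A → A → ℝ
  | 0 => k
  | m + 1 => fun x y => ∫ z, kIter k m x z * k z y

/-- unnormalized posterior density -/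
def postUnnorm {n p : ℕ} (X : Matrix (Fin n) (Fin p) ℝ) (Y : Fin n → Bool)
    (v : Fin p → ℝ) (Q : Matrix (Fin p) (Fin p) ℝ) (β : Fin p → ℝ) : ℝ :=
  (∏ i, if Y i then nPhi (dotProduct (X i) β) else 1 - nPhi (dotProduct (X i) β)) *
    Real.exp (-(dotProduct (β - v) (Q.mulVec (β - v))) / 2)

/-- the (normalized) posterior density -/
def postDen {n p : ℕ} (X : Matrix (Fin n) (Fin p) ℝ) (Y : Fin n → Bool)
    (v : Fin p → ℝ) (Q : Matrix (Fin p) (Fin p) ℝ) (β : Fin p → ℝ) : ℝ :=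
  postUnnorm X Y v Q β / ∫ β', postUnnorm X Y v Q β'

/-- the geometric convergence rate of Albert and Chib's chain:
ρ* = inf{ρ ∈ [0,1] : ∃ M ≥ 0 with ‖K^m(β,·) − Π‖_TV ≤ M(β) ρ^m for all β and m ≥ 1} -/
def rhoStar {n p : ℕ} (X : Matrix (Fin n) (Fin p) ℝ) (Y : Fin n → Bool)
    (v : Fin p → ℝ) (Q : Matrix (Fin p) (Fin p) ℝ) : ℝ :=
  sInf {ρ : ℝ | ρ ∈ Set.Icc (0 : ℝ) 1 ∧ ∃ M : (Fin p → ℝ) → ℝ, (∀ β, 0 ≤ M β) ∧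
    ∀ (β : Fin p → ℝ) (m : ℕ),
      (∫ β', |kIter (kAC X Y v Q) m β β' - postDen X Y v Q β'|) ≤ M β * ρ ^ (m + 1)}

/-- A Markov transition density. -/
structure MarkovDens {A : Type*} [MeasureSpace A] (k : A → A → ℝ) : Prop where
  meas : Measurable (Function.uncurry k)
  nonneg : ∀ x y, 0 ≤ k x y
  integ : ∀ x, Integrable (k x)
  one : ∀ x, ∫ y, k x y = 1

/-- the Markov operator -/
def mop {A : Type*} [MeasureSpace A] (k : A → A → ℝ) (f : A → ℝ) (x : A) : ℝ :=
  ∫ y, k x y * f y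

section generic
variable {A : Type*} [MeasureSpace A] [SigmaFinite (volume : Measure A)]

theorem integrable_mul_bdd {g f : A → ℝ} (hg : Integrable g) (hf : Measurable f) {B : ℝ}
    (hB : ∀ x, |f x| ≤ B) : Integrable (fun x => g x * f x) := by
  exact hg.mul_bdd hf.aestronglyMeasurable (ae_of_all _ (fun x => by simpa using hB x))

theorem mop_meas {k : A → A → ℝ} (hk : MarkovDens k) {f : A → ℝ} (hf : Measurable f) :
    Measurable (mop k f) := by
  have h : Measurable (Function.uncurry fun x y => k x y * f y) :=
    hk.meas.mul (hf.comp measurable_snd)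
  exact (h.stronglyMeasurable.integral_prod_right).measurable

theorem mop_bdd {k : A → A → ℝ} (hk : MarkovDens k) {f : A → ℝ} (hf : Measurable f) {B : ℝ}
    (hB : ∀ x, |f x| ≤ B) (x : A) : |mop k f x| ≤ B := by
  unfold mop
  calc |∫ y, k x y * f y| ≤ ∫ y, |k x y * f y| := abs_integral_le_integral_abs
    _ ≤ ∫ y, k x y * B := by
        apply integral_mono (integrable_mul_bdd (hk.integ x) hf hB).abs ((hk.integ x).mul_const B)
        intro y
        simp only [abs_mul, abs_of_nonneg (hk.nonneg x y)]
        exact mul_le_mul_of_nonneg_left (hB y) (hk.nonneg x y)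
    _ = B := by rw [integral_mul_const, hk.one, one_mul]

/-- Fubini for density times kernel times bounded function -/
theorem dens_integrable_prod {k : A → A → ℝ} (hk : MarkovDens k) {g : A → ℝ} (hg : Measurable g)
    (hgi : Integrable g) {f : A → ℝ} (hf : Measurable f) {B : ℝ} (hB : ∀ x, |f x| ≤ B) :
    Integrable (Function.uncurry fun z y => g z * k z y * f y) (volume.prod volume) := by
  have h0 : Integrable (Function.uncurry fun z y => g z * k z y) (volume.prod volume) := by
    have hm : Measurable (Function.uncurry fun z y => g z * k z y) :=
      (hg.comp measurable_fst).mul hk.meas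
    rw [integrable_prod_iff hm.aestronglyMeasurable]
    refine ⟨ae_of_all _ fun z => (hk.integ z).const_mul (g z), ?_⟩
    have : (fun z => ∫ y, ‖Function.uncurry (fun z y => g z * k z y) (z, y)‖) = fun z => ‖g z‖ := by
      ext z
      simp only [Function.uncurry, norm_mul]
      rw [integral_const_mul]
      have : ∀ y, ‖k z y‖ = k z y := fun y => by
        rw [Real.norm_eq_abs, abs_of_nonneg (hk.nonneg z y)]
      simp only [this, hk.one, mul_one]
    rw [this]
    exact hgi.norm
  exact h0.mul_bdd (hf.comp measurable_snd).aestronglyMeasurable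
    (ae_of_all _ (fun x => by simpa using hB x.2))

theorem fub {k : A → A → ℝ} (hk : MarkovDens k) {g : A → ℝ} (hg : Measurable g)
    (hgi : Integrable g) {f : A → ℝ} (hf : Measurable f) {B : ℝ} (hB : ∀ x, |f x| ≤ B) :
    ∫ y, (∫ z, g z * k z y) * f y = ∫ z, g z * mop k f z := by
  have := integral_integral_swap (dens_integrable_prod hk hg hgi hf hB)
  unfold mop
  simp only [mul_assoc, integral_const_mul, ← integral_mul_const] at this ⊢
  exact this.symm

theorem kIter_markov {k : A → A → ℝ} (hk : MarkovDens k) (m : ℕ) : MarkovDens (kIter k m) := by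
  induction m with
  | zero => exact hk
  | succ m ih =>
    have e1 : ∀ x, Measurable (kIter k m x) := fun x => ih.meas.comp measurable_prodMk_left
    refine ⟨?_, ?_, ?_, ?_⟩
    · have h : Measurable (Function.uncurry fun (q : A × A) z => kIter k m q.1 z * k z q.2) := by
        apply Measurable.mul
        · exact ih.meas.comp ((measurable_fst.comp measurable_fst).prodMk measurable_snd)
        · exact hk.meas.comp (measurable_snd.prodMk (measurable_snd.comp measurable_fst))
      exact (h.stronglyMeasurable.integral_prod_right).measurable
    · intro x y
      exact integral_nonneg fun z => mul_nonneg (ih.nonneg x z) (hk.nonneg z y)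
    · intro x
      have := (dens_integrable_prod hk (e1 x) (ih.integ x) (f := fun _ => 1) measurable_const
        (B := 1) (by simp)).integral_prod_right
      simpa [kIter, Function.uncurry] using this
    · intro x
      have := fub hk (e1 x) (ih.integ x) (f := fun _ => 1) measurable_const
        (B := 1) (by simp)
      simp only [mul_one, mop, hk.one] at this
      rw [ih.one] at this
      exact this

theorem kIter_apply {k : A → A → ℝ} (hk : MarkovDens k) (m : ℕ) : ∀ {f : A → ℝ}, Measurable f →
    ∀ {B : ℝ}, (∀ x, |f x| ≤ B) → ∀ x, ∫ y, kIter k m x y * f y = (mop k)^[m+1] f x := by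
  induction m with
  | zero => intro f hf B hB x; rfl
  | succ m ih =>
    intro f hf B hB x
    have ik := kIter_markov hk m
    rw [Function.iterate_succ_apply, ← ih (mop_meas hk hf) (mop_bdd hk hf hB)]
    exact fub hk (ik.meas.comp measurable_prodMk_left) (ik.integ x) hf hB

theorem stat_iter {k : A → A → ℝ} (hk : MarkovDens k) {g : A → ℝ} (hg : Measurable g)
    (hgi : Integrable g) (hrev : ∀ x y, g x * k x y = g y * k y x) (m : ℕ) :
    ∀ {f : A → ℝ}, Measurable f → ∀ {B : ℝ}, (∀ x, |f x| ≤ B) →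
      ∫ y, g y * (mop k)^[m] f y = ∫ y, g y * f y := by
  induction m with
  | zero => intro f hf B hB; rfl
  | succ m ih =>
    intro f hf B hB
    rw [Function.iterate_succ]
    simp only [Function.comp_apply]
    rw [ih (mop_meas hk hf) (mop_bdd hk hf hB), ← fub hk hg hgi hf hB]
    congr 1; ext y
    simp_rw [hrev _ y]
    rw [integral_const_mul, hk.one, mul_one]

theorem generic_bound {k : A → A → ℝ} (hk : MarkovDens k) {g : A → ℝ} (hg : Measurable g)
    (hgi : Integrable g) (hg0 : ∀ x, 0 ≤ g x) (hg1 : ∫ x, g x = 1)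
    (hrev : ∀ x y, g x * k x y = g y * k y x)
    (D : A → A → ℝ) (hD : ∀ x, Integrable fun y => g y * D x y) (m : ℕ) (r : ℝ)
    (hL : ∀ s : A → ℝ, Measurable s → (∀ x, |s x| ≤ 1) → ∀ x y,
      |(mop k)^[m+1] s x - (mop k)^[m+1] s y| ≤ r * D x y) (x : A) :
    ∫ y, |kIter k m x y - g y| ≤ (∫ y, g y * D x y) * r := by
  have ik := kIter_markov hk m
  have mk : Measurable (kIter k m x) := ik.meas.comp measurable_prodMk_left
  set s : A → ℝ := fun y => if g y ≤ kIter k m x y then 1 else -1 with hs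
  have sm : Measurable s := Measurable.ite (measurableSet_le hg mk) measurable_const measurable_const
  have sb : ∀ y, |s y| ≤ 1 := fun y => by simp only [hs]; split_ifs <;> simp
  have e : ∀ y, |kIter k m x y - g y| = kIter k m x y * s y - g y * s y := fun y => by
    simp only [hs]; split_ifs with h
    · rw [abs_of_nonneg (by linarith)]; ring
    · rw [abs_of_neg (by linarith)]; ring
  simp only [e]
  rw [integral_sub (integrable_mul_bdd (ik.integ x) sm sb) (integrable_mul_bdd hgi sm sb),
    kIter_apply hk m sm sb, ← stat_iter hk hg hgi hrev (m+1) sm sb]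
  have pm : ∀ j, Measurable ((mop k)^[j] s) ∧ ∀ y, |(mop k)^[j] s y| ≤ 1 := by
    intro j
    induction j with
    | zero => exact ⟨sm, sb⟩
    | succ j ih =>
      rw [Function.iterate_succ_apply']
      exact ⟨mop_meas hk ih.1, mop_bdd hk ih.1 ih.2⟩
  have e2 : (mop k)^[m+1] s x = ∫ y, g y * (mop k)^[m+1] s x := by
    rw [integral_mul_const, hg1, one_mul]
  rw [e2, ← integral_sub (hgi.mul_const _) (integrable_mul_bdd hgi (pm _).1 (pm _).2),
    ← integral_mul_const]
  apply integral_mono ((hgi.mul_const _).sub (integrable_mul_bdd hgi (pm _).1 (pm _).2))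
    ((hD x).mul_const r)
  intro y
  have := mul_le_mul_of_nonneg_left ((le_abs_self _).trans (hL s sm sb x y)) (hg0 y)
  simp only [Pi.sub_apply]
  nlinarith [this]

end generic

theorem nphi_eq : nphi = ProbabilityTheory.gaussianPDFReal 0 1 := by
  ext x; simp [nphi, ProbabilityTheory.gaussianPDFReal]

theorem nphi_pos (x : ℝ) : 0 < nphi x := by unfold nphi; positivity

theorem nphi_cont : Continuous nphi := by unfold nphi; fun_prop

theorem nphi_int : Integrable nphi := by
  rw [nphi_eq]; exact ProbabilityTheory.integrable_gaussianPDFReal _ _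

theorem nphi_one : ∫ x, nphi x = 1 := by
  rw [nphi_eq]; exact ProbabilityTheory.integral_gaussianPDFReal_eq_one _ one_ne_zero

theorem nphi_neg (x : ℝ) : nphi (-x) = nphi x := by simp [nphi]

theorem nPhi_cdf (x : ℝ) :
    nPhi x = ProbabilityTheory.cdf (ProbabilityTheory.gaussianReal 0 1) x := by
  rw [ProbabilityTheory.cdf_eq_real, Measure.real,
    ProbabilityTheory.gaussianReal_apply_eq_integral _ one_ne_zero, ENNReal.toReal_ofReal,
    nPhi, nphi_eq]
  exact integral_nonneg fun x => ProbabilityTheory.gaussianPDFReal_nonneg _ _ _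

theorem nPhi_sub (a b : ℝ) : nPhi b - nPhi a = ∫ t in a..b, nphi t := by
  unfold nPhi
  exact intervalIntegral.integral_Iic_sub_Iic nphi_int.integrableOn nphi_int.integrableOn

theorem nPhi_deriv (x : ℝ) : HasDerivAt nPhi (nphi x) x := by
  have h : nPhi = fun y => nPhi 0 + ∫ t in (0:ℝ)..y, nphi t := by
    ext y; rw [← nPhi_sub]; ring
  rw [h]
  exact (intervalIntegral.integral_hasDerivAt_right (nphi_int.intervalIntegrable)
    nphi_cont.stronglyMeasurable.stronglyMeasurableAtFilter nphi_cont.continuousAt).const_add _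

theorem nPhi_cont : Continuous nPhi :=
  continuous_iff_continuousAt.2 fun x => (nPhi_deriv x).continuousAt

theorem nPhi_smono : StrictMono nPhi :=
  strictMono_of_hasDerivAt_pos nPhi_deriv nphi_pos

theorem nPhi_bot : Tendsto nPhi atBot (nhds 0) := by
  have : nPhi = _ := funext nPhi_cdf
  rw [this]; exact ProbabilityTheory.tendsto_cdf_atBot _

theorem nPhi_top : Tendsto nPhi atTop (nhds 1) := by
  have : nPhi = _ := funext nPhi_cdf
  rw [this]; exact ProbabilityTheory.tendsto_cdf_atTop _

theorem nPhi_pos (x : ℝ) : 0 < nPhi x := by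
  have h1 : nPhi (x - 1) < nPhi x := nPhi_smono (by linarith)
  have h2 : 0 ≤ nPhi (x - 1) := by rw [nPhi_cdf]; exact ProbabilityTheory.cdf_nonneg _ _
  linarith

theorem nPhi_lt_one (x : ℝ) : nPhi x < 1 := by
  have h1 : nPhi x < nPhi (x + 1) := nPhi_smono (by linarith)
  have h2 : nPhi (x + 1) ≤ 1 := by rw [nPhi_cdf]; exact ProbabilityTheory.cdf_le_one _ _
  linarith

theorem nPhi_neg (x : ℝ) : nPhi (-x) = 1 - nPhi x := by
  have h1 : nPhi (-x) = ∫ t in Set.Ioi x, nphi t := by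
    unfold nPhi
    rw [← integral_comp_neg_Ioi]
    simp [nphi_neg]
  have h2 : nPhi x + ∫ t in Set.Ioi x, nphi t = 1 := by
    unfold nPhi
    rw [intervalIntegral.integral_Iic_add_Ioi nphi_int.integrableOn nphi_int.integrableOn, nphi_one]
  linarith

/-- key log-concavity inequality -/
theorem nPhi_logconc (θ z : ℝ) (hz : 0 ≤ z) : nPhi (θ - z) * nphi θ ≤ nphi (θ - z) * nPhi θ := by
  have h1 : nPhi (θ - z) = ∫ t in Set.Iic θ, nphi (t - z) := by
    unfold nPhi
    have := integral_indicator (μ := volume) (f := nphi) (measurableSet_Iic (a := θ - z))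
    rw [← this, ← integral_indicator measurableSet_Iic, ← integral_sub_right_eq_self _ z]
    congr 1; ext t
    simp only [Set.indicator, Set.mem_Iic, sub_le_sub_iff_right]
  rw [h1, nPhi, ← integral_mul_const, ← integral_const_mul]
  apply setIntegral_mono_on
  · exact ((nphi_int.comp_sub_right z).mul_const _).integrableOn
  · exact (nphi_int.const_mul _).integrableOn
  · exact measurableSet_Iic
  intro t ht
  have ht : t ≤ θ := ht
  unfold nphi
  have : Real.exp (-((t - z) ^ 2) / 2) * Real.exp (-(θ ^ 2) / 2) ≤
      Real.exp (-((θ - z) ^ 2) / 2) * Real.exp (-(t ^ 2) / 2) := by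
    rw [← Real.exp_add, ← Real.exp_add]
    apply Real.exp_le_exp.2
    nlinarith [mul_nonneg hz (sub_nonneg.2 ht)]
  calc _ = ((Real.sqrt (2 * Real.pi))⁻¹ * (Real.sqrt (2 * Real.pi))⁻¹) *
        (Real.exp (-((t - z) ^ 2) / 2) * Real.exp (-(θ ^ 2) / 2)) := by ring
    _ ≤ ((Real.sqrt (2 * Real.pi))⁻¹ * (Real.sqrt (2 * Real.pi))⁻¹) *
        (Real.exp (-((θ - z) ^ 2) / 2) * Real.exp (-(t ^ 2) / 2)) := by gcongr
    _ = _ := by ring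

theorem surv_mono (z : ℝ) (hz : 0 ≤ z) : Monotone fun θ => nPhi (θ - z) / nPhi θ := by
  have hd : ∀ θ, HasDerivAt (fun θ => nPhi (θ - z) / nPhi θ)
      ((nphi (θ - z) * nPhi θ - nPhi (θ - z) * nphi θ) / nPhi θ ^ 2) θ := fun θ => by
    have := (HasDerivAt.comp_sub_const θ z (nPhi_deriv (θ - z))).div (nPhi_deriv θ) (nPhi_pos θ).ne'
    exact this
  apply monotone_of_hasDerivAt_nonneg hd
  intro θ
  simp only [Pi.zero_apply]
  have := nPhi_logconc θ z hz
  exact div_nonneg (by linarith) (by positivity)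

/-- inverse of nPhi -/
def nInv (u : ℝ) : ℝ := Function.invFun nPhi u

theorem nPhi_nInv {u : ℝ} (hu : u ∈ Set.Ioo (0:ℝ) 1) : nPhi (nInv u) = u := by
  apply Function.invFun_eq
  obtain ⟨a, ha⟩ := (nPhi_bot.eventually (gt_mem_nhds hu.1)).exists
  obtain ⟨b, hb⟩ := (nPhi_top.eventually (lt_mem_nhds hu.2)).exists
  exact mem_range_of_exists_le_of_exists_ge nPhi_cont ⟨a, ha.le⟩ ⟨b, hb.le⟩

theorem nInv_le {u x : ℝ} (hu : u ∈ Set.Ioo (0:ℝ) 1) : x ≤ nInv u ↔ nPhi x ≤ u := by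
  rw [← nPhi_smono.le_iff_le, nPhi_nInv hu]

theorem umem (θ : ℝ) {u : ℝ} (hu : u ∈ Set.Ioo (0:ℝ) 1) : u * nPhi θ ∈ Set.Ioo (0:ℝ) 1 :=
  ⟨mul_pos hu.1 (nPhi_pos θ), by nlinarith [hu.1, hu.2, nPhi_pos θ, nPhi_lt_one θ]⟩

/-- quantile map for TN(θ,1;1) -/
def G1 (θ u : ℝ) : ℝ := θ - nInv (u * nPhi θ)

/-- quantile map for TN(θ,1;b) -/
def Gz (b : Bool) (θ u : ℝ) : ℝ := if b then G1 θ u else -G1 (-θ) u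

theorem G1_le {θ u a : ℝ} (hu : u ∈ Set.Ioo (0:ℝ) 1) :
    G1 θ u ≤ a ↔ nPhi (θ - a) / nPhi θ ≤ u := by
  rw [div_le_iff₀ (nPhi_pos θ), ← nInv_le (umem θ hu), G1]
  constructor <;> intro h <;> linarith

theorem G1_nonneg {θ u : ℝ} (hu : u ∈ Set.Ioo (0:ℝ) 1) : 0 < G1 θ u := by
  rw [← not_le, G1_le hu, sub_zero, div_self (nPhi_pos θ).ne']
  exact not_le.2 hu.2

theorem G1_lip_aux {θ θ' u : ℝ} (hu : u ∈ Set.Ioo (0:ℝ) 1) (h : θ ≤ θ') :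
    |G1 θ u - G1 θ' u| ≤ θ' - θ := by
  have h1 : G1 θ u ≤ G1 θ' u := by
    rw [G1_le hu]
    have h2 := (G1_le (θ := θ') (a := G1 θ' u) hu).1 le_rfl
    exact (surv_mono _ (G1_nonneg hu).le h).trans h2
  have h3 : nInv (u * nPhi θ) ≤ nInv (u * nPhi θ') := by
    rw [nInv_le (umem θ' hu), nPhi_nInv (umem θ hu)]
    exact mul_le_mul_of_nonneg_left (nPhi_smono.monotone h) hu.1.le
  rw [abs_of_nonpos (by linarith)]
  unfold G1; linarith

theorem G1_lip {θ θ' u : ℝ} (hu : u ∈ Set.Ioo (0:ℝ) 1) :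
    |G1 θ u - G1 θ' u| ≤ |θ - θ'| := by
  rcases le_total θ θ' with h | h
  · rw [abs_sub_comm θ, abs_of_nonneg (sub_nonneg.2 h)]; exact G1_lip_aux hu h
  · rw [abs_sub_comm, abs_of_nonneg (sub_nonneg.2 h)]; exact G1_lip_aux hu h

theorem Gz_lip (b : Bool) {θ θ' u : ℝ} (hu : u ∈ Set.Ioo (0:ℝ) 1) :
    |Gz b θ u - Gz b θ' u| ≤ |θ - θ'| := by
  cases b
  · have := G1_lip (θ := -θ) (θ' := -θ') hu
    simp only [Gz, Bool.false_eq_true, if_false]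
    rw [show -G1 (-θ) u - -G1 (-θ') u = -(G1 (-θ) u - G1 (-θ') u) by ring, abs_neg]
    rwa [show -θ - -θ' = -(θ - θ') by ring, abs_neg] at this
  · simpa [Gz] using G1_lip hu

theorem G1_aemeas (θ : ℝ) : AEMeasurable (G1 θ) (volume.restrict (Set.Ioo (0:ℝ) 1)) := by
  apply aemeasurable_restrict_of_antitoneOn measurableSet_Ioo
  intro u hu u' hu' h
  have : nInv (u * nPhi θ) ≤ nInv (u' * nPhi θ) := by
    rw [nInv_le (umem θ hu'), nPhi_nInv (umem θ hu)]
    exact mul_le_mul_of_nonneg_right h (nPhi_pos θ).le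
  unfold G1; linarith

theorem Gz_aemeas (b : Bool) (θ : ℝ) :
    AEMeasurable (Gz b θ) (volume.restrict (Set.Ioo (0:ℝ) 1)) := by
  cases b
  · have : Gz false θ = fun u => -G1 (-θ) u := by ext u; simp [Gz]
    rw [this]; exact (G1_aemeas _).neg
  · have : Gz true θ = G1 θ := by ext u; simp [Gz]
    rw [this]; exact G1_aemeas _

theorem tn_nonneg (θ : ℝ) (b : Bool) (z : ℝ) : 0 ≤ tn θ b z := by
  unfold tn
  have := nphi_pos (z - θ)
  have := nPhi_pos θ
  have : 0 < 1 - nPhi θ := sub_pos.2 (nPhi_lt_one θ)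
  split_ifs <;> positivity

theorem tn_meas2 (b : Bool) : Measurable fun q : ℝ × ℝ => tn q.1 b q.2 := by
  have h1 : Measurable nphi := nphi_cont.measurable
  have h2 : Measurable nPhi := nPhi_cont.measurable
  cases b
  · simp only [tn, Bool.false_eq_true, if_false]
    exact Measurable.ite (measurableSet_lt measurable_snd measurable_const) (by fun_prop)
      measurable_const
  · simp only [tn, if_true]
    exact Measurable.ite (measurableSet_lt measurable_const measurable_snd) (by fun_prop)
      measurable_const

theorem tn_meas (θ : ℝ) (b : Bool) : Measurable (tn θ b) :=
  (tn_meas2 b).comp measurable_prodMk_left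

theorem tn_false (θ z : ℝ) : tn θ false z = tn (-θ) true (-z) := by
  simp only [tn, Bool.false_eq_true, if_false, if_true, neg_pos]
  rw [← nPhi_neg, show -z - -θ = -(z - θ) by ring, nphi_neg]

theorem lint_tn_Iic (θ a : ℝ) (ha : 0 ≤ a) :
    ∫⁻ z in Set.Iic a, ENNReal.ofReal (tn θ true z) =
      ENNReal.ofReal (1 - nPhi (θ - a) / nPhi θ) := by
  have e : ∀ z, (Set.Iic a).indicator (fun z => ENNReal.ofReal (tn θ true z)) z =
      (Set.Ioc 0 a).indicator (fun z => ENNReal.ofReal (nphi (z - θ) / nPhi θ)) z := by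
    intro z
    simp only [Set.indicator, Set.mem_Iic, Set.mem_Ioc, tn, if_true]
    split_ifs <;> simp_all
  rw [← lintegral_indicator measurableSet_Iic, lintegral_congr e,
    lintegral_indicator measurableSet_Ioc, ← ofReal_integral_eq_lintegral_ofReal]
  · rw [← intervalIntegral.integral_of_le ha, intervalIntegral.integral_div,
      intervalIntegral.integral_comp_sub_right, ← nPhi_sub]
    congr 1
    have := nPhi_neg (θ - a)
    have h2 := nPhi_neg θ
    rw [show -(θ - a) = a - θ by ring] at this
    rw [zero_sub, this, h2]
    have := (nPhi_pos θ).ne'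
    field_simp; ring
  · exact ((nphi_int.comp_sub_right θ).div_const _).integrableOn
  · exact ae_of_all _ fun z => div_nonneg (nphi_pos _).le (nPhi_pos _).le

theorem lint_tn_Iic' (θ a : ℝ) (ha : a ≤ 0) :
    ∫⁻ z in Set.Iic a, ENNReal.ofReal (tn θ true z) = 0 := by
  rw [setLIntegral_congr_fun (g := fun _ => 0) measurableSet_Iic]
  · simp
  · intro z hz
    have : ¬ 0 < z := not_lt.2 (le_trans hz ha)
    simp [tn, this]

theorem G1_map (θ : ℝ) : (volume.restrict (Set.Ioo (0:ℝ) 1)).map (G1 θ) =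
    volume.withDensity (fun z => ENNReal.ofReal (tn θ true z)) := by
  have : IsProbabilityMeasure (volume.restrict (Set.Ioo (0:ℝ) 1)) := ⟨by simp⟩
  have := Measure.isProbabilityMeasure_map (G1_aemeas θ)
  apply Measure.ext_of_Iic
  intro a
  rw [Measure.map_apply_of_aemeasurable (G1_aemeas θ) measurableSet_Iic,
    withDensity_apply _ measurableSet_Iic,
    Measure.restrict_apply₀']
  swap
  · exact measurableSet_Ioo.nullMeasurableSet
  have hset : G1 θ ⁻¹' Set.Iic a ∩ Set.Ioo 0 1 = Set.Ici (nPhi (θ - a) / nPhi θ) ∩ Set.Ioo 0 1 := by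
    ext u
    simp only [Set.mem_inter_iff, Set.mem_preimage, Set.mem_Iic, Set.mem_Ici]
    exact and_congr_left fun hu => G1_le hu
  rw [hset]
  have hp : 0 < nPhi (θ - a) / nPhi θ := div_pos (nPhi_pos _) (nPhi_pos _)
  have h2 : Set.Ici (nPhi (θ - a) / nPhi θ) ∩ Set.Ioo 0 1 = Set.Ico (nPhi (θ - a) / nPhi θ) 1 := by
    ext u
    simp only [Set.mem_inter_iff, Set.mem_Ici, Set.mem_Ioo, Set.mem_Ico]
    constructor
    · rintro ⟨h, h', h''⟩; exact ⟨h, h''⟩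
    · rintro ⟨h, h'⟩; exact ⟨h, lt_of_lt_of_le hp h, h'⟩
  rw [h2, Real.volume_Ico]
  rcases le_total 0 a with ha | ha
  · rw [lint_tn_Iic θ a ha]
  · rw [lint_tn_Iic' θ a ha]
    apply ENNReal.ofReal_of_nonpos
    have : nPhi θ ≤ nPhi (θ - a) := nPhi_smono.monotone (by linarith)
    have := (one_le_div (nPhi_pos θ)).2 this
    linarith

theorem Gz_map (b : Bool) (θ : ℝ) : (volume.restrict (Set.Ioo (0:ℝ) 1)).map (Gz b θ) =
    volume.withDensity (fun z => ENNReal.ofReal (tn θ b z)) := by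
  cases b
  · have : Gz false θ = (fun x => -x) ∘ G1 (-θ) := by ext u; simp [Gz]
    rw [this, ← AEMeasurable.map_map_of_aemeasurable measurable_neg.aemeasurable (G1_aemeas _),
      G1_map]
    ext s hs
    rw [Measure.map_apply measurable_neg hs, withDensity_apply _ hs,
      withDensity_apply _ (measurable_neg hs)]
    have := (Measure.measurePreserving_neg (volume : Measure ℝ)).setLIntegral_comp_preimage hs
      (f := fun z => ENNReal.ofReal (tn θ false z)) (tn_meas θ false).ennreal_ofReal
    rw [← this]
    simp only [tn_false, neg_neg]
  · have : Gz true θ = G1 θ := by ext u; simp [Gz]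
    rw [this]; exact G1_map _

theorem pi_dens {n : ℕ} (d : Fin n → ℝ → ℝ) (hm : ∀ i, Measurable (d i)) (h0 : ∀ i z, 0 ≤ d i z)
    (hi : ∀ i, Integrable (d i)) :
    Measure.pi (fun i => (volume : Measure ℝ).withDensity fun z => ENNReal.ofReal (d i z)) =
      (volume : Measure (Fin n → ℝ)).withDensity fun z => ENNReal.ofReal (∏ i, d i (z i)) := by
  have : ∀ i, IsFiniteMeasure ((volume : Measure ℝ).withDensity fun z => ENNReal.ofReal (d i z)) :=
    fun i => isFiniteMeasure_withDensity_ofReal (hi i).2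
  apply Measure.pi_eq
  intro s hs
  rw [withDensity_apply _ (MeasurableSet.univ_pi hs), ← lintegral_indicator (MeasurableSet.univ_pi hs)]
  have e : ∀ z : Fin n → ℝ, (Set.univ.pi s).indicator
      (fun z => ENNReal.ofReal (∏ i, d i (z i))) z =
      ENNReal.ofReal (∏ i, (s i).indicator (d i) (z i)) := by
    intro z
    by_cases hz : z ∈ Set.univ.pi s
    · rw [Set.indicator_of_mem hz]
      congr 1
      apply Finset.prod_congr rfl
      intro i _
      rw [Set.indicator_of_mem (hz i trivial)]
    · rw [Set.indicator_of_notMem hz]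
      simp only [Set.mem_univ_pi, not_forall] at hz
      obtain ⟨i, hi⟩ := hz
      rw [Finset.prod_eq_zero (Finset.mem_univ i) (Set.indicator_of_notMem hi _)]
      simp
  have hii : ∀ i, Integrable ((s i).indicator (d i)) := fun i => (hi i).indicator (hs i)
  have h00 : ∀ i z, 0 ≤ (s i).indicator (d i) z := fun i z =>
    Set.indicator_nonneg (fun z _ => h0 i z) z
  rw [lintegral_congr e, ← ofReal_integral_eq_lintegral_ofReal]
  · rw [integral_fintype_prod_volume_eq_prod, ENNReal.ofReal_prod_of_nonneg]
    · apply Finset.prod_congr rfl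
      intro i _
      rw [withDensity_apply _ (hs i), integral_indicator (hs i),
        ofReal_integral_eq_lintegral_ofReal (hi i).integrableOn (ae_of_all _ (h0 i))]
    · intro i _
      exact integral_nonneg (h00 i)
  · exact Integrable.fintype_prod hii
  · exact ae_of_all _ fun z => Finset.prod_nonneg fun i _ => h00 i _

theorem tn_int (θ : ℝ) (b : Bool) : Integrable (tn θ b) := by
  refine ⟨(tn_meas θ b).aestronglyMeasurable, ?_⟩
  rw [hasFiniteIntegral_iff_ofReal (ae_of_all _ (tn_nonneg θ b))]
  have h := congrArg (fun μ => μ Set.univ) (Gz_map b θ)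
  simp only [withDensity_apply _ MeasurableSet.univ, Measure.restrict_univ] at h
  rw [← h, Measure.map_apply_of_aemeasurable (Gz_aemeas b θ) MeasurableSet.univ]
  simp

/-- uniform law on the cube -/
def cube (n : ℕ) : Measure (Fin n → ℝ) :=
  Measure.pi fun _ => volume.restrict (Set.Ioo (0:ℝ) 1)

instance uprob : IsProbabilityMeasure (volume.restrict (Set.Ioo (0:ℝ) 1)) := ⟨by simp⟩
instance cubeprob (n : ℕ) : IsProbabilityMeasure (cube n) := by unfold cube; infer_instance

/-- the quantile coupling -/
def ZZ {n : ℕ} (Y : Fin n → Bool) (θ : Fin n → ℝ) (u : Fin n → ℝ) : Fin n → ℝ :=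
  fun i => Gz (Y i) (θ i) (u i)

theorem ZZ_map {n : ℕ} (Y : Fin n → Bool) (θ : Fin n → ℝ) :
    (cube n).map (ZZ Y θ) =
      (volume : Measure (Fin n → ℝ)).withDensity fun z =>
        ENNReal.ofReal (∏ i, tn (θ i) (Y i) (z i)) := by
  rw [← pi_dens _ (fun i => tn_meas _ _) (fun i => tn_nonneg _ _) (fun i => tn_int _ _)]
  have := fun i => Measure.isProbabilityMeasure_map (Gz_aemeas (Y i) (θ i))
  have h := Measure.pi_map_pi (μ := fun _ : Fin n => volume.restrict (Set.Ioo (0:ℝ) 1))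
    (f := fun i => Gz (Y i) (θ i)) (fun i => Gz_aemeas _ _)
  simp only [Gz_map] at h
  exact h

theorem ZZ_aemeas {n : ℕ} (Y : Fin n → Bool) (θ : Fin n → ℝ) : AEMeasurable (ZZ Y θ) (cube n) := by
  apply aemeasurable_pi_lambda
  intro i
  exact (Gz_aemeas _ _).comp_quasiMeasurePreserving (Measure.quasiMeasurePreserving_eval _ i)

theorem ZZ_integral {n : ℕ} (Y : Fin n → Bool) (θ : Fin n → ℝ) (g : (Fin n → ℝ) → ℝ)
    (hg : Measurable g) :
    ∫ z, g z * ∏ i, tn (θ i) (Y i) (z i) = ∫ u, g (ZZ Y θ u) ∂(cube n) := by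
  rw [← integral_map (ZZ_aemeas Y θ) hg.aestronglyMeasurable, ZZ_map]
  have hm : Measurable fun z : Fin n → ℝ => ∏ i, tn (θ i) (Y i) (z i) :=
    Finset.measurable_prod _ fun i _ => (tn_meas _ _).comp (measurable_pi_apply i)
  have h0 : ∀ z : Fin n → ℝ, 0 ≤ ∏ i, tn (θ i) (Y i) (z i) := fun z =>
    Finset.prod_nonneg fun i _ => tn_nonneg _ _ _
  rw [integral_withDensity_eq_integral_toReal_smul hm.ennreal_ofReal (by simp)]
  congr 1; ext z
  rw [ENNReal.toReal_ofReal (h0 z), smul_eq_mul, mul_comm]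

theorem cube_ae {n : ℕ} : ∀ᵐ u ∂(cube n), ∀ i, u i ∈ Set.Ioo (0:ℝ) 1 := by
  rw [ae_all_iff]
  intro i
  exact (Measure.quasiMeasurePreserving_eval (fun _ : Fin n => volume.restrict (Set.Ioo (0:ℝ) 1)) i).ae
    (ae_restrict_mem measurableSet_Ioo)

theorem ZZ_prod_int {n : ℕ} (Y : Fin n → Bool) (θ : Fin n → ℝ) :
    Integrable fun z : Fin n → ℝ => ∏ i, tn (θ i) (Y i) (z i) :=
  Integrable.fintype_prod fun i => tn_int _ _

/-- quadratic form -/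
def qf {p : ℕ} (S : Matrix (Fin p) (Fin p) ℝ) (x : Fin p → ℝ) : ℝ := dotProduct x (S.mulVec x)

theorem bil_bound {m p : ℕ} (S : Matrix (Fin m) (Fin p) ℝ) :
    ∃ K : ℝ, 0 ≤ K ∧ ∀ (u : Fin m → ℝ) (w : Fin p → ℝ), |dotProduct u (S.mulVec w)| ≤ K * ‖u‖ * ‖w‖ := by
  refine ⟨∑ i, ∑ j, |S i j|, by positivity, fun u w => ?_⟩
  simp only [dotProduct, mulVec, Finset.mul_sum, Finset.sum_mul]
  refine (Finset.abs_sum_le_sum_abs _ _).trans (Finset.sum_le_sum fun i _ => ?_)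
  refine (Finset.abs_sum_le_sum_abs _ _).trans (Finset.sum_le_sum fun j _ => ?_)
  rw [abs_mul, abs_mul]
  have h1 : |u i| ≤ ‖u‖ := norm_le_pi_norm u i
  have h2 : |w j| ≤ ‖w‖ := norm_le_pi_norm w j
  calc |u i| * (|S i j| * |w j|) ≤ ‖u‖ * (|S i j| * ‖w‖) := by gcongr
    _ = _ := by ring

theorem mulVec_bound {m p : ℕ} (S : Matrix (Fin m) (Fin p) ℝ) :
    ∃ K : ℝ, 0 ≤ K ∧ ∀ (w : Fin p → ℝ), ‖S.mulVec w‖ ≤ K * ‖w‖ := by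
  refine ⟨∑ i, ∑ j, |S i j|, by positivity, fun w => ?_⟩
  rw [pi_norm_le_iff_of_nonneg (by positivity)]
  intro i
  rw [Real.norm_eq_abs]
  simp only [dotProduct, mulVec]
  refine (Finset.abs_sum_le_sum_abs _ _).trans ?_
  calc ∑ j, |S i j * w j| ≤ ∑ j, |S i j| * ‖w‖ := Finset.sum_le_sum fun j _ => by
        rw [abs_mul]; exact mul_le_mul_of_nonneg_left (norm_le_pi_norm w j) (abs_nonneg _)
    _ = (∑ j, |S i j|) * ‖w‖ := by rw [Finset.sum_mul]
    _ ≤ _ := by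
        gcongr
        exact Finset.single_le_sum (f := fun i => ∑ j, |S i j|) (fun i _ => by positivity)
          (Finset.mem_univ i)

open scoped MatrixOrder in
theorem posdef_factor {p : ℕ} {S : Matrix (Fin p) (Fin p) ℝ} (hS : S.PosDef) :
    ∃ B : Matrix (Fin p) (Fin p) ℝ, B.det ≠ 0 ∧ S.det = B.det ^ 2 ∧
      ∀ x, qf S x = ∑ i, (B.mulVec x) i ^ 2 := by
  obtain ⟨B, hB⟩ := CStarAlgebra.nonneg_iff_eq_star_mul_self.mp hS.posSemidef.nonneg
  have hB' : S = Bᵀ * B := by rw [hB, star_eq_conjTranspose, conjTranspose_eq_transpose_of_trivial]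
  have hdet : S.det = B.det ^ 2 := by rw [hB', det_mul, det_transpose]; ring
  refine ⟨B, ?_, hdet, fun x => ?_⟩
  · intro h
    have := hS.det_pos
    rw [hdet, h] at this; simp at this
  · rw [qf, hB', ← mulVec_mulVec, dotProduct_mulVec, vecMul_transpose]
    simp [dotProduct, sq]

theorem qf_nonneg {p : ℕ} {S : Matrix (Fin p) (Fin p) ℝ} (hS : S.PosDef) (x : Fin p → ℝ) :
    0 ≤ qf S x := by
  obtain ⟨B, _, _, h⟩ := posdef_factor hS
  rw [h]; positivity

theorem quad_bound {p : ℕ} {S : Matrix (Fin p) (Fin p) ℝ} (hS : S.PosDef) :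
    ∃ C : ℝ, 0 ≤ C ∧ ∀ x, ‖x‖ ≤ C * Real.sqrt (qf S x) := by
  obtain ⟨B, hB, _, h⟩ := posdef_factor hS
  obtain ⟨K, hK, hb⟩ := mulVec_bound B⁻¹
  refine ⟨K, hK, fun x => ?_⟩
  have h1 : x = B⁻¹.mulVec (B.mulVec x) := by
    rw [mulVec_mulVec, nonsing_inv_mul _ (isUnit_iff_ne_zero.2 hB), one_mulVec]
  calc ‖x‖ = ‖B⁻¹.mulVec (B.mulVec x)‖ := by rw [← h1]
    _ ≤ K * ‖B.mulVec x‖ := hb _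
    _ ≤ K * Real.sqrt (qf S x) := by
      gcongr
      rw [pi_norm_le_iff_of_nonneg (by positivity)]
      intro i
      rw [Real.norm_eq_abs]
      apply Real.abs_le_sqrt
      rw [h]
      exact Finset.single_le_sum (f := fun i => (B.mulVec x) i ^ 2) (fun i _ => by positivity)
          (Finset.mem_univ i)

theorem std_int (p : ℕ) : Integrable (fun y : Fin p → ℝ => ∏ i, Real.exp (-(1/2) * y i ^ 2)) :=
  Integrable.fintype_prod fun _ => integrable_exp_neg_mul_sq (by norm_num)

theorem std_val (p : ℕ) : ∫ y : Fin p → ℝ, ∏ i, Real.exp (-(1/2) * y i ^ 2) =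
    Real.sqrt (2 * Real.pi) ^ p := by
  rw [integral_fintype_prod_volume_eq_pow (fun t : ℝ => Real.exp (-(1/2) * t ^ 2)),
    integral_gaussian, Fintype.card_fin]
  congr 2; ring

theorem gauss_aux {p : ℕ} {S : Matrix (Fin p) (Fin p) ℝ} (hS : S.PosDef) :
    Integrable (fun x => Real.exp (-(qf S x) / 2)) ∧
      ∫ x, Real.exp (-(qf S x) / 2) = Real.sqrt (2 * Real.pi) ^ p * (Real.sqrt S.det)⁻¹ := by
  obtain ⟨B, hB, hd, h⟩ := posdef_factor hS
  have hm := Real.map_matrix_volume_pi_eq_smul_volume_pi hB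
  have e : (fun x => Real.exp (-(qf S x) / 2)) =
      (fun y : Fin p → ℝ => ∏ i, Real.exp (-(1/2) * y i ^ 2)) ∘ (toLin' B) := by
    ext x
    simp only [Function.comp_apply, toLin'_apply]
    rw [h, ← Real.exp_sum, ← Finset.mul_sum]
    congr 1; ring
  have hmeas : Measurable (toLin' B) := (LinearMap.continuous_on_pi _).measurable
  have hmF : Measurable (fun y : Fin p → ℝ => ∏ i, Real.exp (-(1/2) * y i ^ 2)) := by fun_prop
  constructor
  · rw [e, ← integrable_map_measure hmF.aestronglyMeasurable hmeas.aemeasurable, hm]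
    exact (std_int p).smul_measure ENNReal.ofReal_ne_top
  · rw [e, Function.comp_def, ← integral_map hmeas.aemeasurable hmF.aestronglyMeasurable, hm, integral_smul_measure,
      std_val, ENNReal.toReal_ofReal (abs_nonneg _), hd, Real.sqrt_sq_eq_abs, smul_eq_mul, mul_comm,
      abs_inv]

theorem qf_cont {p : ℕ} (S : Matrix (Fin p) (Fin p) ℝ) : Continuous (qf S) := by
  unfold qf dotProduct mulVec dotProduct
  fun_prop

theorem gauss_int1 {p : ℕ} {S : Matrix (Fin p) (Fin p) ℝ} (hS : S.PosDef) :
    Integrable (fun x => ‖x‖ * Real.exp (-(qf S x) / 2)) := by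
  obtain ⟨C, hC, hb⟩ := quad_bound hS
  have hS2 : ((1/2 : ℝ) • S).PosDef := hS.smul (by norm_num)
  have h2 : ∀ x, qf ((1/2 : ℝ) • S) x = qf S x / 2 := fun x => by
    unfold qf; rw [smul_mulVec, dotProduct_smul, smul_eq_mul]; ring
  have hi := (gauss_aux hS2).1.const_mul C
  refine hi.mono' ?_ (ae_of_all _ fun x => ?_)
  · have := qf_cont S
    exact Continuous.aestronglyMeasurable (by fun_prop)
  · rw [Real.norm_eq_abs, abs_of_nonneg (by positivity), h2]
    set t := Real.sqrt (qf S x) with ht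
    have hq : qf S x = t ^ 2 := (Real.sq_sqrt (qf_nonneg hS x)).symm
    have ht0 : 0 ≤ t := Real.sqrt_nonneg _
    rw [hq]
    have h3 : t ≤ Real.exp (t ^ 2 / 4) := by
      have := Real.add_one_le_exp (t ^ 2 / 4)
      nlinarith [sq_nonneg (t - 2)]
    calc ‖x‖ * Real.exp (-t ^ 2 / 2) ≤ (C * t) * Real.exp (-t ^ 2 / 2) := by gcongr; exact hb x
      _ ≤ (C * Real.exp (t ^ 2 / 4)) * Real.exp (-t ^ 2 / 2) := by gcongr
      _ = C * Real.exp (-(t ^ 2 / 2) / 2) := by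
        rw [mul_assoc, ← Real.exp_add]; congr 2; ring

/-- normalizing constant -/
def nconst {p : ℕ} (S : Matrix (Fin p) (Fin p) ℝ) : ℝ := Real.sqrt (((2 * Real.pi) ^ p * S⁻¹.det)⁻¹)

theorem mvn_eq {p : ℕ} {S : Matrix (Fin p) (Fin p) ℝ} (hS : S.PosDef) (μ x : Fin p → ℝ) :
    mvn μ S⁻¹ x = nconst S * Real.exp (-(qf S (x - μ)) / 2) := by
  unfold mvn nconst qf
  rw [nonsing_inv_nonsing_inv _ (isUnit_iff_ne_zero.2 hS.det_pos.ne')]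

theorem nconst_nonneg {p : ℕ} (S : Matrix (Fin p) (Fin p) ℝ) : 0 ≤ nconst S := Real.sqrt_nonneg _

theorem mvn_nonneg {p : ℕ} (μ : Fin p → ℝ) (S : Matrix (Fin p) (Fin p) ℝ) (x : Fin p → ℝ) :
    0 ≤ mvn μ S x := by unfold mvn; positivity

theorem mvn_int {p : ℕ} {S : Matrix (Fin p) (Fin p) ℝ} (hS : S.PosDef) (μ : Fin p → ℝ) :
    Integrable (mvn μ S⁻¹) := by
  have : mvn μ S⁻¹ = fun x => nconst S * Real.exp (-(qf S (x - μ)) / 2) := funext (mvn_eq hS μ)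
  rw [this]
  exact ((gauss_aux hS).1.comp_sub_right μ).const_mul _

theorem mvn_one {p : ℕ} {S : Matrix (Fin p) (Fin p) ℝ} (hS : S.PosDef) (μ : Fin p → ℝ) :
    ∫ x, mvn μ S⁻¹ x = 1 := by
  simp only [mvn_eq hS]
  rw [integral_const_mul, integral_sub_right_eq_self (fun x => Real.exp (-(qf S x) / 2)) μ,
    (gauss_aux hS).2, nconst, det_nonsing_inv]
  have hd := hS.det_pos
  rw [Ring.inverse_eq_inv', mul_inv, inv_inv, Real.sqrt_mul (by positivity), Real.sqrt_inv]
  rw [show Real.sqrt ((2 * Real.pi) ^ p) = Real.sqrt (2 * Real.pi) ^ p by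
    rw [Real.sqrt_eq_rpow, Real.sqrt_eq_rpow, ← Real.rpow_natCast, ← Real.rpow_natCast,
      ← Real.rpow_mul (by positivity), ← Real.rpow_mul (by positivity), mul_comm (p : ℝ)]]
  have h1 : Real.sqrt S.det ≠ 0 := (Real.sqrt_pos.2 hd).ne'
  have h2 : Real.sqrt (2 * Real.pi) ^ p ≠ 0 := by positivity
  field_simp

theorem exp_lip (a b : ℝ) :
    |Real.exp a - Real.exp b| ≤ |a - b| * (Real.exp a + Real.exp b) := by
  wlog h : b ≤ a with H
  · have := H b a (le_of_not_ge h)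
    rw [abs_sub_comm, abs_sub_comm a b, add_comm]; exact this
  rw [abs_of_nonneg (sub_nonneg.2 (Real.exp_le_exp.2 h)), abs_of_nonneg (sub_nonneg.2 h)]
  have h1 := Real.add_one_le_exp (b - a)
  have h2 : Real.exp b = Real.exp a * Real.exp (b - a) := by rw [← Real.exp_add]; congr 1; ring
  have h3 := Real.exp_pos a
  have h4 := Real.exp_pos b
  nlinarith [mul_le_mul_of_nonneg_left h1 h3.le, mul_nonneg (sub_nonneg.2 h) h4.le]

theorem qf_diff {p : ℕ} {S : Matrix (Fin p) (Fin p) ℝ} (hS : S.PosDef) (x y : Fin p → ℝ) :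
    qf S x - qf S y = dotProduct (x - y) (S.mulVec (x + y)) := by
  have hs : Sᵀ = S := by
    have := hS.isHermitian.eq
    rwa [conjTranspose_eq_transpose_of_trivial] at this
  have h : dotProduct x (S.mulVec y) = dotProduct y (S.mulVec x) := by
    rw [dotProduct_mulVec, ← mulVec_transpose, hs, dotProduct_comm]
  unfold qf
  rw [mulVec_add, dotProduct_add, sub_dotProduct, sub_dotProduct, h]
  ring

theorem gauss_tv {p : ℕ} {S : Matrix (Fin p) (Fin p) ℝ} (hS : S.PosDef) :
    ∃ C : ℝ, 0 ≤ C ∧ ∀ μ μ' : Fin p → ℝ,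
      ∫ x, |mvn μ S⁻¹ x - mvn μ' S⁻¹ x| ≤ C * ‖μ - μ'‖ := by
  obtain ⟨K, hK, hb⟩ := bil_bound S
  set w : (Fin p → ℝ) → ℝ := fun x => Real.exp (-(qf S x) / 2) with hw
  have wi : Integrable w := (gauss_aux hS).1
  have w1 : Integrable (fun x => ‖x‖ * w x) := gauss_int1 hS
  set J : (Fin p → ℝ) → ℝ := fun x => 2 * (‖x‖ * w x) + w x with hJ
  have Ji : Integrable J := (w1.const_mul 2).add wi
  have J0 : 0 ≤ ∫ x, J x := integral_nonneg fun x => by simp only [hJ, hw, Pi.zero_apply]; positivity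
  have c0 := nconst_nonneg S
  refine ⟨2 + nconst S * K * ∫ x, J x, by positivity, fun μ μ' => ?_⟩
  by_cases hd : 1 < ‖μ - μ'‖
  · calc ∫ x, |mvn μ S⁻¹ x - mvn μ' S⁻¹ x| ≤ ∫ x, (mvn μ S⁻¹ x + mvn μ' S⁻¹ x) := by
          apply integral_mono ((mvn_int hS μ).sub (mvn_int hS μ')).abs
            ((mvn_int hS μ).add (mvn_int hS μ'))
          intro x
          have h1 := mvn_nonneg μ S⁻¹ x
          have h2 := mvn_nonneg μ' S⁻¹ x
          simp only [Pi.sub_apply, Pi.add_apply]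
          rw [abs_le]; constructor <;> linarith
      _ = 2 := by
          rw [integral_add (mvn_int hS μ) (mvn_int hS μ'), mvn_one hS, mvn_one hS]; norm_num
      _ ≤ 2 * ‖μ - μ'‖ := by linarith
      _ ≤ _ := by gcongr; linarith [show 0 ≤ nconst S * K * ∫ x, J x by positivity]
  · push Not at hd
    have key : ∀ x, |mvn μ S⁻¹ x - mvn μ' S⁻¹ x| ≤
        (nconst S * K * ‖μ - μ'‖ / 2) * (J (x - μ) + J (x - μ')) := by
      intro x
      rw [mvn_eq hS, mvn_eq hS, ← mul_sub, abs_mul, abs_of_nonneg c0]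
      have e1 := exp_lip (-(qf S (x - μ)) / 2) (-(qf S (x - μ')) / 2)
      have e2 : |(-(qf S (x - μ)) / 2) - (-(qf S (x - μ')) / 2)| ≤
          K * ‖μ - μ'‖ * (‖x - μ‖ + ‖x - μ'‖) / 2 := by
        rw [show (-(qf S (x - μ)) / 2) - (-(qf S (x - μ')) / 2) =
          (qf S (x - μ') - qf S (x - μ)) / 2 by ring, abs_div, abs_of_pos (two_pos (α := ℝ)), qf_diff hS]
        have := hb (x - μ' - (x - μ)) (x - μ' + (x - μ))
        rw [show x - μ' - (x - μ) = μ - μ' by abel] at this ⊢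
        have t := norm_add_le (x - μ') (x - μ)
        have : K * ‖μ - μ'‖ * ‖x - μ' + (x - μ)‖ ≤ K * ‖μ - μ'‖ * (‖x - μ‖ + ‖x - μ'‖) := by
          gcongr; linarith
        linarith
      have n1 : ‖x - μ‖ ≤ ‖x - μ'‖ + 1 := by
        have := norm_sub_le (x - μ') (μ - μ')
        rw [show x - μ' - (μ - μ') = x - μ by abel] at this; linarith
      have n2 : ‖x - μ'‖ ≤ ‖x - μ‖ + 1 := by
        have := norm_add_le (x - μ) (μ - μ')
        rw [show x - μ + (μ - μ') = x - μ' by abel] at this; linarith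
      have p1 := Real.exp_pos (-(qf S (x - μ)) / 2)
      have p2 := Real.exp_pos (-(qf S (x - μ')) / 2)
      simp only [hJ, hw]
      set a := Real.exp (-(qf S (x - μ)) / 2)
      set b := Real.exp (-(qf S (x - μ')) / 2)
      have e3 : (‖x - μ‖ + ‖x - μ'‖) * (a + b) ≤
          (2 * (‖x - μ‖ * a) + a + (2 * (‖x - μ'‖ * b) + b)) := by
        nlinarith
      calc nconst S * |a - b| ≤ nconst S * ((K * ‖μ - μ'‖ * (‖x - μ‖ + ‖x - μ'‖) / 2) * (a + b)) := by
            gcongr; exact e1.trans (by gcongr)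
        _ = (nconst S * K * ‖μ - μ'‖ / 2) * ((‖x - μ‖ + ‖x - μ'‖) * (a + b)) := by ring
        _ ≤ _ := by gcongr
    calc ∫ x, |mvn μ S⁻¹ x - mvn μ' S⁻¹ x|
        ≤ ∫ x, (nconst S * K * ‖μ - μ'‖ / 2) * (J (x - μ) + J (x - μ')) := by
          apply integral_mono ((mvn_int hS μ).sub (mvn_int hS μ')).abs _ key
          exact ((Ji.comp_sub_right μ).add (Ji.comp_sub_right μ')).const_mul _
      _ = (nconst S * K * ∫ x, J x) * ‖μ - μ'‖ := by
          rw [integral_const_mul, integral_add (Ji.comp_sub_right μ) (Ji.comp_sub_right μ'),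
            integral_sub_right_eq_self, integral_sub_right_eq_self]
          ring
      _ ≤ _ := by gcongr; linarith

/-- Euclidean norm -/
def en {m : ℕ} (x : Fin m → ℝ) : ℝ := Real.sqrt (normSq x)

theorem normSq_nonneg {m : ℕ} (x : Fin m → ℝ) : 0 ≤ normSq x := by unfold normSq; positivity

theorem normSq_dot {m : ℕ} (x : Fin m → ℝ) : normSq x = dotProduct x x := by
  simp [normSq, dotProduct, sq]

theorem en_nonneg {m : ℕ} (x : Fin m → ℝ) : 0 ≤ en x := Real.sqrt_nonneg _

theorem norm_le_en {m : ℕ} (x : Fin m → ℝ) : ‖x‖ ≤ en x := by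
  rw [pi_norm_le_iff_of_nonneg (en_nonneg x)]
  intro i
  rw [Real.norm_eq_abs]
  apply Real.abs_le_sqrt
  exact Finset.single_le_sum (f := fun i => x i ^ 2) (fun i _ => by positivity) (Finset.mem_univ i)

theorem en_le_norm {m : ℕ} (x : Fin m → ℝ) : en x ≤ Real.sqrt m * ‖x‖ := by
  rw [en, ← Real.sqrt_sq (norm_nonneg x), ← Real.sqrt_mul (by positivity)]
  apply Real.sqrt_le_sqrt
  calc normSq x ≤ ∑ _i : Fin m, ‖x‖ ^ 2 := by
        unfold normSq
        apply Finset.sum_le_sum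
        intro i _
        rw [← sq_abs]
        exact pow_le_pow_left₀ (abs_nonneg _) (norm_le_pi_norm x i) 2
    _ = _ := by simp

theorem en_mono {m : ℕ} {x y : Fin m → ℝ} (h : ∀ i, |x i| ≤ |y i|) : en x ≤ en y := by
  apply Real.sqrt_le_sqrt
  apply Finset.sum_le_sum
  intro i _
  exact sq_le_sq.2 (h i)

theorem dot_le_en {m : ℕ} (x y : Fin m → ℝ) : dotProduct x y ≤ en x * en y :=
  Real.sum_mul_le_sqrt_mul_sqrt _ _ _

theorem lmax_bound {m : ℕ} {M : Matrix (Fin m) (Fin m) ℝ} {c : ℝ} (h : lmax M < c)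
    (a : Fin m → ℝ) : dotProduct a (M.mulVec a) ≤ c * normSq a := by
  obtain ⟨K, hK, hb⟩ := bil_bound M
  by_cases ha : a = 0
  · subst ha; simp [normSq]
  have pos : ∀ x : Fin m → ℝ, x ≠ 0 → 0 < normSq x := fun x hx => by
    have h1 : 0 < ‖x‖ := norm_pos_iff.2 hx
    have h2 := norm_le_en x
    exact Real.sqrt_pos.1 (lt_of_lt_of_le h1 h2)
  have bdd : BddAbove {r : ℝ | ∃ x : Fin m → ℝ, x ≠ 0 ∧ r = dotProduct x (M.mulVec x) / normSq x} := by
    refine ⟨K, ?_⟩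
    rintro r ⟨x, hx, rfl⟩
    rw [div_le_iff₀ (pos x hx)]
    have h1 := (le_abs_self _).trans (hb x x)
    have h2 := norm_le_en x
    have h3 : ‖x‖ * ‖x‖ ≤ normSq x := by
      rw [← Real.mul_self_sqrt (normSq_nonneg x)]
      exact mul_self_le_mul_self (norm_nonneg _) h2
    nlinarith
  have := le_csSup bdd ⟨a, ha, rfl⟩
  rw [← div_le_iff₀ (pos a ha)]
  exact this.trans h.le

section main
variable {n p : ℕ} (X : Matrix (Fin n) (Fin p) ℝ) (Y : Fin n → Bool)
    (v : Fin p → ℝ) {Q : Matrix (Fin p) (Fin p) ℝ}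

theorem Spd (hQ : Q.PosDef) : (Xᵀ * X + Q).PosDef := by
  have := posSemidef_conjTranspose_mul_self X
  rw [conjTranspose_eq_transpose_of_trivial] at this
  exact PosDef.posSemidef_add this hQ

theorem pd_symm {S : Matrix (Fin p) (Fin p) ℝ} (hS : S.PosDef) (x y : Fin p → ℝ) :
    dotProduct x (S.mulVec y) = dotProduct y (S.mulVec x) := by
  have hs : Sᵀ = S := by
    have := hS.isHermitian.eq
    rwa [conjTranspose_eq_transpose_of_trivial] at this
  rw [dotProduct_mulVec, ← mulVec_transpose, hs, dotProduct_comm]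

theorem pd_mul_inv {S : Matrix (Fin p) (Fin p) ℝ} (hS : S.PosDef) (x : Fin p → ℝ) :
    S.mulVec (S⁻¹.mulVec x) = x := by
  rw [mulVec_mulVec, mul_nonsing_inv _ (isUnit_iff_ne_zero.2 hS.det_pos.ne'), one_mulVec]

theorem dot_tr (w : Fin p → ℝ) (a : Fin n → ℝ) :
    dotProduct w (Xᵀ.mulVec a) = dotProduct (X.mulVec w) a := by
  rw [dotProduct_mulVec, vecMul_transpose]

theorem contraction (hQ : Q.PosDef) {c : ℝ} (hc : 0 < c)
    (hl : ∀ a, dotProduct a ((X * Q⁻¹ * Xᵀ).mulVec a) ≤ c * normSq a) (u : Fin n → ℝ) :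
    en (X.mulVec ((Xᵀ * X + Q)⁻¹.mulVec (Xᵀ.mulVec u))) ≤ c / (1 + c) * en u := by
  set w := (Xᵀ * X + Q)⁻¹.mulVec (Xᵀ.mulVec u) with hw
  have h1 : (Xᵀ * X + Q).mulVec w = Xᵀ.mulVec u := pd_mul_inv (Spd X hQ) _
  set a := X.mulVec w with ha
  have h2 : dotProduct a u = normSq a + qf Q w := by
    rw [ha, ← dot_tr, ← h1, add_mulVec, dotProduct_add, ← mulVec_mulVec, dot_tr, normSq_dot, qf]
  set b := Q⁻¹.mulVec (Xᵀ.mulVec a) with hb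
  have h3 : Q.mulVec b = Xᵀ.mulVec a := pd_mul_inv hQ _
  have h4 : qf Q b ≤ c * normSq a := by
    have := hl a
    rw [← mulVec_mulVec, ← mulVec_mulVec, ← hb] at this
    rw [qf, h3, dot_tr, dotProduct_comm]; exact this
  have h5 : 0 ≤ qf Q w - 2 * c⁻¹ * normSq a + c⁻¹ ^ 2 * qf Q b := by
    have := qf_nonneg hQ (w - c⁻¹ • b)
    have e : qf Q (w - c⁻¹ • b) = qf Q w - 2 * c⁻¹ * normSq a + c⁻¹ ^ 2 * qf Q b := by
      have e1 : dotProduct b (Q.mulVec w) = normSq a := by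
        rw [pd_symm hQ, h3, dot_tr, normSq_dot]
      have e2 : dotProduct w (Q.mulVec b) = normSq a := by rw [pd_symm hQ, e1]
      simp only [qf, mulVec_sub, mulVec_smul, dotProduct_sub, sub_dotProduct, smul_dotProduct,
        dotProduct_smul, smul_eq_mul, e1, e2]
      ring
    rwa [e] at this
  have h6 : c⁻¹ * normSq a ≤ qf Q w := by
    have : c⁻¹ ^ 2 * qf Q b ≤ c⁻¹ * normSq a := by
      calc c⁻¹ ^ 2 * qf Q b ≤ c⁻¹ ^ 2 * (c * normSq a) := by gcongr
        _ = _ := by field_simp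
    linarith
  have h7 := dot_le_en a u
  have h8 : normSq a = en a * en a := (Real.mul_self_sqrt (normSq_nonneg a)).symm
  have h9 : (1 + c⁻¹) * en a * en a ≤ en u * en a := by
    have e9 : (1 + c⁻¹) * en a * en a = en a * en a + c⁻¹ * (en a * en a) := by ring
    rw [e9, ← h8]
    linarith [mul_comm (en a) (en u)]
  rcases (en_nonneg a).eq_or_lt with h | h
  · rw [← h]; have := en_nonneg u; positivity
  · have := le_of_mul_le_mul_right h9 h
    rw [div_mul_eq_mul_div, le_div_iff₀ (by positivity)]
    have e : c * ((1 + c⁻¹) * en a) = en a * (1 + c) := by field_simp; ring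
    rw [← e]
    exact mul_le_mul_of_nonneg_left this hc.le

/-- conditional mean -/
def cm (Q : Matrix (Fin p) (Fin p) ℝ) (z : Fin n → ℝ) : Fin p → ℝ :=
  (Xᵀ * X + Q)⁻¹.mulVec (Xᵀ.mulVec z + Q.mulVec v)

theorem cm_sub (z z' : Fin n → ℝ) :
    cm X v Q z - cm X v Q z' = (Xᵀ * X + Q)⁻¹.mulVec (Xᵀ.mulVec (z - z')) := by
  unfold cm
  rw [← mulVec_sub, mulVec_sub Xᵀ]; congr 1; abel

theorem mulVec_cont {m k : ℕ} (M : Matrix (Fin m) (Fin k) ℝ) : Continuous fun x => M.mulVec x := by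
  unfold mulVec dotProduct; fun_prop

theorem cm_cont : Continuous (cm X v Q) := by
  unfold cm
  exact (mulVec_cont _).comp ((mulVec_cont _).add continuous_const)

theorem mvn_meas (hQ : Q.PosDef) :
    Measurable fun q : (Fin n → ℝ) × (Fin p → ℝ) => mvn (cm X v Q q.1) (Xᵀ * X + Q)⁻¹ q.2 := by
  simp only [mvn_eq (Spd X hQ)]
  have h1 := qf_cont (Xᵀ * X + Q)
  have h2 := cm_cont (Q := Q) X v
  exact Continuous.measurable (by fun_prop)

/-- the z-density -/
def td (β : Fin p → ℝ) (z : Fin n → ℝ) : ℝ := ∏ i, tn (dotProduct (X i) β) (Y i) (z i)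

theorem kAC_eq (β β' : Fin p → ℝ) : kAC X Y v Q β β' =
    ∫ z, mvn (cm X v Q z) (Xᵀ * X + Q)⁻¹ β' * td X Y β z := rfl

theorem td_nonneg (β : Fin p → ℝ) (z : Fin n → ℝ) : 0 ≤ td X Y β z :=
  Finset.prod_nonneg fun _ _ => tn_nonneg _ _ _

theorem td_meas2 : Measurable fun q : (Fin p → ℝ) × (Fin n → ℝ) => td X Y q.1 q.2 := by
  unfold td
  apply Finset.measurable_prod
  intro i _
  have h : Measurable fun q : (Fin p → ℝ) × (Fin n → ℝ) => (dotProduct (X i) q.1, q.2 i) := by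
    apply Continuous.measurable
    unfold dotProduct
    fun_prop
  exact (tn_meas2 (Y i)).comp h

theorem td_meas (β : Fin p → ℝ) : Measurable (td X Y β) := (td_meas2 X Y).comp measurable_prodMk_left

theorem td_int (β : Fin p → ℝ) : Integrable (td X Y β) :=
  ZZ_prod_int Y fun i => dotProduct (X i) β

theorem td_integral (β : Fin p → ℝ) (g : (Fin n → ℝ) → ℝ) (hg : Measurable g) :
    ∫ z, g z * td X Y β z = ∫ u, g (ZZ Y (X.mulVec β) u) ∂(cube n) :=
  ZZ_integral Y (X.mulVec β) g hg

/-- conditional expectation given z -/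
def ce (Q : Matrix (Fin p) (Fin p) ℝ) (f : (Fin p → ℝ) → ℝ) (z : Fin n → ℝ) : ℝ :=
  ∫ y, mvn (cm X v Q z) (Xᵀ * X + Q)⁻¹ y * f y

theorem gen_H_int {E F : Type*} [MeasureSpace E] [MeasureSpace F]
    [SigmaFinite (volume : Measure E)] [SigmaFinite (volume : Measure F)]
    (g : E → F → ℝ) (t : E → ℝ) (f : F → ℝ)
    (hg : Measurable fun q : E × F => g q.1 q.2) (ht : Measurable t)
    (gi : ∀ z, Integrable (g z)) (g1 : ∀ z, ∫ y, g z y = 1) (g0 : ∀ z y, 0 ≤ g z y)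
    (t0 : ∀ z, 0 ≤ t z) (ti : Integrable t) (hf : Measurable f) {B : ℝ} (hB : ∀ x, |f x| ≤ B) :
    Integrable (Function.uncurry fun z y => g z y * t z * f y) (volume.prod volume) := by
  have h0 : Integrable (Function.uncurry fun z y => g z y * t z) (volume.prod volume) := by
    have hm : Measurable (Function.uncurry fun z y => g z y * t z) :=
      hg.mul (ht.comp measurable_fst)
    rw [integrable_prod_iff hm.aestronglyMeasurable]
    refine ⟨ae_of_all _ fun z => (gi z).mul_const (t z), ?_⟩
    have : (fun z => ∫ y, ‖Function.uncurry (fun z y => g z y * t z) (z, y)‖) = fun z => t z := by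
      ext z
      have : ∀ y, ‖g z y * t z‖ = g z y * t z := fun y => by
        rw [Real.norm_eq_abs, abs_of_nonneg (mul_nonneg (g0 _ _) (t0 z))]
      simp only [Function.uncurry, this]
      rw [integral_mul_const, g1, one_mul]
    rw [this]
    exact ti
  exact h0.mul_bdd (hf.comp measurable_snd).aestronglyMeasurable
    (ae_of_all _ (fun x => by simpa using hB x.2))

theorem gen_meas {E F : Type*} [MeasureSpace E] [MeasureSpace F]
    [SigmaFinite (volume : Measure E)]
    (g : E → F → ℝ) (t : F → E → ℝ)
    (hg : Measurable fun q : E × F => g q.1 q.2) (ht : Measurable fun q : F × E => t q.1 q.2) :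
    Measurable fun q : F × F => ∫ z, g z q.2 * t q.1 z := by
  have h : Measurable (Function.uncurry fun (q : F × F) (z : E) => g z q.2 * t q.1 z) :=
    (hg.comp (measurable_snd.prodMk (measurable_snd.comp measurable_fst))).mul
      (ht.comp ((measurable_fst.comp measurable_fst).prodMk measurable_snd))
  exact (h.stronglyMeasurable.integral_prod_right).measurable

theorem H_int (hQ : Q.PosDef) (β : Fin p → ℝ) {f : (Fin p → ℝ) → ℝ} (hf : Measurable f) {B : ℝ}
    (hB : ∀ x, |f x| ≤ B) :
    Integrable (Function.uncurry fun z y => mvn (cm X v Q z) (Xᵀ * X + Q)⁻¹ y * td X Y β z * f y)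
      (volume.prod volume) :=
  gen_H_int (fun z y => mvn (cm X v Q z) (Xᵀ * X + Q)⁻¹ y) (td X Y β) f (mvn_meas X v hQ)
    (td_meas X Y β) (fun z => mvn_int (Spd X hQ) _) (fun z => mvn_one (Spd X hQ) _)
    (fun z y => mvn_nonneg _ _ _) (td_nonneg X Y β) (td_int X Y β) hf hB

theorem ce_meas (hQ : Q.PosDef) {f : (Fin p → ℝ) → ℝ} (hf : Measurable f) :
    Measurable (ce X v Q f) := by
  have h : Measurable (Function.uncurry fun (z : Fin n → ℝ) y =>
      mvn (cm X v Q z) (Xᵀ * X + Q)⁻¹ y * f y) :=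
    (mvn_meas X v hQ).mul (hf.comp measurable_snd)
  exact (h.stronglyMeasurable.integral_prod_right).measurable

theorem mop_eq (hQ : Q.PosDef) (β : Fin p → ℝ) {f : (Fin p → ℝ) → ℝ} (hf : Measurable f) {B : ℝ}
    (hB : ∀ x, |f x| ≤ B) :
    mop (kAC X Y v Q) f β = ∫ u, ce X v Q f (ZZ Y (X.mulVec β) u) ∂(cube n) := by
  rw [← td_integral X Y β _ (ce_meas X v hQ hf)]
  have h := integral_integral_swap (H_int X Y v hQ β hf hB)
  unfold mop ce
  simp only [kAC_eq, ← integral_mul_const]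
  rw [← h]
  congr 1; ext z; congr 1; ext y; ring

theorem kAC_markov (hQ : Q.PosDef) : MarkovDens (kAC X Y v Q) := by
  have h1 : ∀ x : Fin p → ℝ, |(fun _ => (1:ℝ)) x| ≤ 1 := by simp
  refine ⟨?_, ?_, ?_, ?_⟩
  · exact gen_meas (fun z y => mvn (cm X v Q z) (Xᵀ * X + Q)⁻¹ y) (td X Y) (mvn_meas X v hQ)
      (td_meas2 X Y)
  · intro x y
    exact integral_nonneg fun z => mul_nonneg (mvn_nonneg _ _ _) (td_nonneg X Y x z)
  · intro x
    have := (H_int X Y v hQ x (f := fun _ => 1) measurable_const h1).integral_prod_right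
    simp only [mul_one, Function.uncurry] at this
    exact this
  · intro x
    have := mop_eq X Y v hQ x (f := fun _ => 1) measurable_const h1
    simp only [mop, mul_one, ce, mvn_one (Spd X hQ)] at this
    simpa using this

theorem ce_bdd (hQ : Q.PosDef) {f : (Fin p → ℝ) → ℝ} (hf : Measurable f) {B : ℝ}
    (hB : ∀ x, |f x| ≤ B) (z : Fin n → ℝ) : |ce X v Q f z| ≤ B := by
  unfold ce
  have hi := mvn_int (Spd X hQ) (cm X v Q z)
  calc _ ≤ ∫ y, |mvn (cm X v Q z) (Xᵀ * X + Q)⁻¹ y * f y| := abs_integral_le_integral_abs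
    _ ≤ ∫ y, mvn (cm X v Q z) (Xᵀ * X + Q)⁻¹ y * B := by
        apply integral_mono (integrable_mul_bdd hi hf hB).abs (hi.mul_const B)
        intro y
        simp only [abs_mul, abs_of_nonneg (mvn_nonneg (cm X v Q z) (Xᵀ * X + Q)⁻¹ y)]
        exact mul_le_mul_of_nonneg_left (hB y) (mvn_nonneg _ _ _)
    _ = B := by rw [integral_mul_const, mvn_one (Spd X hQ), one_mul]

/-- the coupling step -/
theorem coup (hQ : Q.PosDef) {f : (Fin p → ℝ) → ℝ} (hf : Measurable f) {B L : ℝ} (hL0 : 0 ≤ L)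
    (hB : ∀ x, |f x| ≤ B) (hL : ∀ z z', |ce X v Q f z - ce X v Q f z'| ≤ L * en (z - z'))
    (x y : Fin p → ℝ) :
    |mop (kAC X Y v Q) f x - mop (kAC X Y v Q) f y| ≤ L * en (X.mulVec x - X.mulVec y) := by
  rw [mop_eq X Y v hQ x hf hB, mop_eq X Y v hQ y hf hB]
  have hi : ∀ θ, Integrable (fun u => ce X v Q f (ZZ Y θ u)) (cube n) := fun θ => by
    refine Integrable.of_bound (C := B) ?_ (ae_of_all _ fun u => ?_)
    · exact ((ce_meas X v hQ hf).comp_aemeasurable (ZZ_aemeas Y θ)).aestronglyMeasurable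
    · exact ce_bdd X v hQ hf hB _
  rw [← integral_sub (hi _) (hi _), ← Real.norm_eq_abs]
  have := norm_integral_le_of_norm_le_const (μ := cube n)
    (f := fun u => ce X v Q f (ZZ Y (X.mulVec x) u) - ce X v Q f (ZZ Y (X.mulVec y) u))
    (C := L * en (X.mulVec x - X.mulVec y)) ?_
  · simpa using this
  · filter_upwards [cube_ae (n := n)] with u hu
    rw [Real.norm_eq_abs]
    refine (hL _ _).trans ?_
    gcongr
    apply en_mono
    intro i
    exact Gz_lip (Y i) (hu i)

theorem ce_lip (hQ : Q.PosDef) {c : ℝ} (hc : 0 < c)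
    (hl : ∀ a, dotProduct a ((X * Q⁻¹ * Xᵀ).mulVec a) ≤ c * normSq a)
    {f : (Fin p → ℝ) → ℝ} (hf : Measurable f) {B L : ℝ} (hL0 : 0 ≤ L)
    (hB : ∀ x, |f x| ≤ B) (hL : ∀ x y, |f x - f y| ≤ L * en (X.mulVec x - X.mulVec y))
    (z z' : Fin n → ℝ) :
    |ce X v Q f z - ce X v Q f z'| ≤ (L * (c / (1 + c))) * en (z - z') := by
  have hS := Spd X hQ
  have e : ∀ z, ce X v Q f z = ∫ y, mvn 0 (Xᵀ * X + Q)⁻¹ y * f (y + cm X v Q z) := fun z => by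
    unfold ce
    rw [← integral_add_right_eq_self _ (cm X v Q z)]
    simp only [mvn_eq hS, add_sub_cancel_right, sub_zero]
  have hi : ∀ z, Integrable fun y => mvn 0 (Xᵀ * X + Q)⁻¹ y * f (y + cm X v Q z) := fun z =>
    integrable_mul_bdd (mvn_int hS 0) (hf.comp (measurable_add_const _)) (fun x => hB _)
  rw [e, e, ← integral_sub (hi z) (hi z')]
  calc _ ≤ ∫ y, |mvn 0 (Xᵀ * X + Q)⁻¹ y * f (y + cm X v Q z) -
        mvn 0 (Xᵀ * X + Q)⁻¹ y * f (y + cm X v Q z')| := abs_integral_le_integral_abs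
    _ ≤ ∫ y, mvn 0 (Xᵀ * X + Q)⁻¹ y * ((L * (c / (1 + c))) * en (z - z')) := by
      apply integral_mono ((hi z).sub (hi z')).abs ((mvn_int hS 0).mul_const _)
      intro y
      have h0 := mvn_nonneg 0 (Xᵀ * X + Q)⁻¹ y
      simp only [Pi.sub_apply]
      rw [← mul_sub, abs_mul, abs_of_nonneg h0]
      refine mul_le_mul_of_nonneg_left ?_ h0
      refine (hL _ _).trans ?_
      rw [← mulVec_sub, add_sub_add_left_eq_sub, cm_sub, mul_assoc]
      exact mul_le_mul_of_nonneg_left (contraction X hQ hc hl _) hL0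
    _ = _ := by rw [integral_mul_const, mvn_one hS, one_mul]

theorem ce_base (hQ : Q.PosDef) : ∃ C : ℝ, 0 ≤ C ∧
    ∀ f : (Fin p → ℝ) → ℝ, Measurable f → (∀ x, |f x| ≤ 1) → ∀ z z' : Fin n → ℝ,
    |ce X v Q f z - ce X v Q f z'| ≤ C * en (z - z') := by
  have hS := Spd X hQ
  obtain ⟨C, hC, h⟩ := gauss_tv hS
  obtain ⟨K, hK, hb⟩ := mulVec_bound ((Xᵀ * X + Q)⁻¹ * Xᵀ)
  refine ⟨C * K, by positivity, fun f hf h1 z z' => ?_⟩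
  unfold ce
  have hi : ∀ z : Fin n → ℝ, Integrable fun y => mvn (cm X v Q z) (Xᵀ * X + Q)⁻¹ y * f y := fun z =>
    integrable_mul_bdd (mvn_int hS _) hf h1
  rw [← integral_sub (hi z) (hi z')]
  calc _ ≤ ∫ y, |mvn (cm X v Q z) (Xᵀ * X + Q)⁻¹ y * f y -
        mvn (cm X v Q z') (Xᵀ * X + Q)⁻¹ y * f y| := abs_integral_le_integral_abs
    _ ≤ ∫ y, |mvn (cm X v Q z) (Xᵀ * X + Q)⁻¹ y - mvn (cm X v Q z') (Xᵀ * X + Q)⁻¹ y| := by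
      apply integral_mono ((hi z).sub (hi z')).abs ((mvn_int hS _).sub (mvn_int hS _)).abs
      intro y
      simp only [Pi.sub_apply]
      rw [← sub_mul, abs_mul]
      exact mul_le_of_le_one_right (abs_nonneg _) (h1 y)
    _ ≤ C * ‖cm X v Q z - cm X v Q z'‖ := h _ _
    _ ≤ C * (K * ‖z - z'‖) := by
      gcongr
      rw [cm_sub, mulVec_mulVec]; exact hb _
    _ ≤ C * (K * en (z - z')) := by gcongr; exact norm_le_en _
    _ = _ := by ring

theorem iter_lip (hQ : Q.PosDef) {c : ℝ} (hc : 0 < c)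
    (hl : ∀ a, dotProduct a ((X * Q⁻¹ * Xᵀ).mulVec a) ≤ c * normSq a) : ∃ C : ℝ, 0 ≤ C ∧
    ∀ (m : ℕ) (s : (Fin p → ℝ) → ℝ), Measurable s → (∀ x, |s x| ≤ 1) → ∀ x y,
      |(mop (kAC X Y v Q))^[m+1] s x - (mop (kAC X Y v Q))^[m+1] s y| ≤
        (C * (c / (1 + c)) ^ m) * en (X.mulVec x - X.mulVec y) := by
  obtain ⟨C, hC, h⟩ := ce_base X v hQ
  have hk := kAC_markov X Y v hQ
  refine ⟨C, hC, fun m s sm sb => ?_⟩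
  have pm : ∀ j, Measurable ((mop (kAC X Y v Q))^[j] s) ∧
      ∀ y, |(mop (kAC X Y v Q))^[j] s y| ≤ 1 := by
    intro j
    induction j with
    | zero => exact ⟨sm, sb⟩
    | succ j ih =>
      rw [Function.iterate_succ_apply']
      exact ⟨mop_meas hk ih.1, mop_bdd hk ih.1 ih.2⟩
  induction m with
  | zero =>
    intro x y
    simp only [pow_zero, mul_one]
    exact coup X Y v hQ sm hC sb (h s sm sb) x y
  | succ m ih =>
    intro x y
    rw [Function.iterate_succ_apply', pow_succ, ← mul_assoc]
    exact coup X Y v hQ (pm _).1 (by positivity) (pm _).2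
      (ce_lip X v hQ hc hl (pm _).1 (by positivity) (pm _).2 ih) x y

/-- likelihood factor -/
def lk (b : Bool) (θ : ℝ) : ℝ := if b then nPhi θ else 1 - nPhi θ

theorem lk_pos (b : Bool) (θ : ℝ) : 0 < lk b θ := by
  unfold lk; split_ifs
  · exact nPhi_pos _
  · exact sub_pos.2 (nPhi_lt_one _)

theorem lk_le (b : Bool) (θ : ℝ) : lk b θ ≤ 1 := by
  unfold lk; split_ifs
  · exact (nPhi_lt_one _).le
  · linarith [nPhi_pos θ]

theorem lk_cont (b : Bool) : Continuous (lk b) := by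
  unfold lk
  have := nPhi_cont
  cases b <;> simp <;> fun_prop

theorem post_eq (β : Fin p → ℝ) : postUnnorm X Y v Q β =
    (∏ i, lk (Y i) (X.mulVec β i)) * Real.exp (-(qf Q (β - v)) / 2) := rfl

/-- sign indicator -/
def sgi (b : Bool) (z : ℝ) : ℝ := if b then (if 0 < z then 1 else 0) else (if z < 0 then 1 else 0)

theorem lk_tn (b : Bool) (θ z : ℝ) : lk b θ * tn θ b z = sgi b z * nphi (z - θ) := by
  have h := (lk_pos b θ).ne'
  unfold lk at h
  unfold lk tn sgi
  cases b <;> simp only [Bool.false_eq_true, if_true, if_false] at h ⊢ <;> split_ifs <;>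
    field_simp <;> simp

theorem prod_nphi (w : Fin n → ℝ) :
    ∏ i, nphi (w i) = (Real.sqrt (2 * Real.pi))⁻¹ ^ n * Real.exp (-(normSq w) / 2) := by
  unfold nphi normSq
  rw [Finset.prod_mul_distrib, Finset.prod_const, ← Real.exp_sum]
  simp only [Finset.card_univ, Fintype.card_fin]
  congr 2
  rw [← Finset.sum_neg_distrib, Finset.sum_div]

theorem square_id (hQ : Q.PosDef) (β β' : Fin p → ℝ) (z : Fin n → ℝ) :
    qf Q (β - v) + normSq (z - X.mulVec β) + qf (Xᵀ * X + Q) (β' - cm X v Q z) =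
    qf Q (β' - v) + normSq (z - X.mulVec β') + qf (Xᵀ * X + Q) (β - cm X v Q z) := by
  have hS := Spd X hQ
  have hcm : (Xᵀ * X + Q).mulVec (cm X v Q z) = Xᵀ.mulVec z + Q.mulVec v := pd_mul_inv hS _
  have a1 := qf_diff hQ (β - v) (β' - v)
  have a2 := qf_diff hS (β - cm X v Q z) (β' - cm X v Q z)
  rw [sub_sub_sub_cancel_right] at a1 a2
  simp only [mulVec_add, mulVec_sub, hcm] at a1 a2
  simp only [add_mulVec, ← mulVec_mulVec, dotProduct_add, dotProduct_sub, dot_tr] at a1 a2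
  have a3 : normSq (z - X.mulVec β) - normSq (z - X.mulVec β') =
      -2 * dotProduct (X.mulVec (β - β')) z + dotProduct (X.mulVec (β - β')) (X.mulVec β)
       + dotProduct (X.mulVec (β - β')) (X.mulVec β') := by
    simp only [normSq_dot, mulVec_sub, dotProduct_sub, sub_dotProduct,
      dotProduct_comm z, dotProduct_comm (X.mulVec β') (X.mulVec β)]
    ring
  linarith

theorem rev (hQ : Q.PosDef) (β β' : Fin p → ℝ) :
    postUnnorm X Y v Q β * kAC X Y v Q β β' = postUnnorm X Y v Q β' * kAC X Y v Q β' β := by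
  have key : ∀ β β' : Fin p → ℝ, postUnnorm X Y v Q β * kAC X Y v Q β β' =
      ∫ z : Fin n → ℝ, (nconst (Xᵀ * X + Q) * (∏ i, sgi (Y i) (z i)) *
        (Real.sqrt (2 * Real.pi))⁻¹ ^ n) *
        Real.exp (-(qf Q (β - v) + normSq (z - X.mulVec β) +
          qf (Xᵀ * X + Q) (β' - cm X v Q z)) / 2) := by
    intro β β'
    rw [kAC_eq, ← integral_const_mul]
    congr 1; ext z
    rw [post_eq, mvn_eq (Spd X hQ)]
    have e1 : (∏ i, lk (Y i) (X.mulVec β i)) * td X Y β z = (∏ i, sgi (Y i) (z i)) *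
        ((Real.sqrt (2 * Real.pi))⁻¹ ^ n * Real.exp (-(normSq (z - X.mulVec β)) / 2)) := by
      rw [← prod_nphi, td, ← Finset.prod_mul_distrib, ← Finset.prod_mul_distrib]
      exact Finset.prod_congr rfl fun i _ => lk_tn _ _ _
    rw [show -(qf Q (β - v) + normSq (z - X.mulVec β) +
          qf (Xᵀ * X + Q) (β' - cm X v Q z)) / 2 = -(qf Q (β - v)) / 2 +
          -(normSq (z - X.mulVec β)) / 2 + -(qf (Xᵀ * X + Q) (β' - cm X v Q z)) / 2 by ring,
      Real.exp_add, Real.exp_add]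
    calc _ = ((∏ i, lk (Y i) (X.mulVec β i)) * td X Y β z) * (Real.exp (-(qf Q (β - v)) / 2) *
          (nconst (Xᵀ * X + Q) * Real.exp (-(qf (Xᵀ * X + Q) (β' - cm X v Q z)) / 2))) := by ring
      _ = _ := by rw [e1]; ring
  rw [key, key]
  congr 1; ext z
  rw [square_id X v hQ]

theorem post_pos (β : Fin p → ℝ) : 0 < postUnnorm X Y v Q β := by
  rw [post_eq]
  exact mul_pos (Finset.prod_pos fun i _ => lk_pos _ _) (Real.exp_pos _)

theorem post_le (β : Fin p → ℝ) : postUnnorm X Y v Q β ≤ Real.exp (-(qf Q (β - v)) / 2) := by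
  rw [post_eq]
  exact mul_le_of_le_one_left (Real.exp_pos _).le
    (Finset.prod_le_one (fun i _ => (lk_pos _ _).le) fun i _ => lk_le _ _)

theorem post_cont : Continuous (postUnnorm X Y v Q) := by
  have : postUnnorm X Y v Q = fun β =>
    (∏ i, lk (Y i) (X.mulVec β i)) * Real.exp (-(qf Q (β - v)) / 2) := rfl
  rw [this]
  have h1 := qf_cont Q
  have h2 := mulVec_cont X
  apply Continuous.mul
  · exact continuous_finsetProd _ fun i _ =>
      (lk_cont (Y i)).comp ((continuous_apply i).comp h2)
  · fun_prop

theorem post_int (hQ : Q.PosDef) : Integrable (postUnnorm X Y v Q) := by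
  refine ((gauss_aux hQ).1.comp_sub_right v).mono' (post_cont X Y v).aestronglyMeasurable
    (ae_of_all _ fun β => ?_)
  rw [Real.norm_eq_abs, abs_of_pos (post_pos X Y v β)]
  exact post_le X Y v β

theorem post_int1 (hQ : Q.PosDef) (x : Fin p → ℝ) :
    Integrable fun y => postUnnorm X Y v Q y * en (X.mulVec x - X.mulVec y) := by
  obtain ⟨K, hK, hb⟩ := mulVec_bound X
  have hi : Integrable fun y => Real.sqrt n * K * ((‖y - v‖ * Real.exp (-(qf Q (y - v)) / 2)) +
      ‖x - v‖ * Real.exp (-(qf Q (y - v)) / 2)) :=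
    (((gauss_int1 hQ).comp_sub_right v).add
      (((gauss_aux hQ).1.comp_sub_right v).const_mul _)).const_mul _
  refine hi.mono' ?_ (ae_of_all _ fun y => ?_)
  · have h1 := post_cont X Y v (Q := Q)
    have h2 := mulVec_cont X
    have h3 : Continuous (en (m := n)) := by unfold en normSq; fun_prop
    exact Continuous.aestronglyMeasurable (by fun_prop)
  · rw [Real.norm_eq_abs, abs_of_nonneg (mul_nonneg (post_pos X Y v y).le (en_nonneg _))]
    have e1 : en (X.mulVec x - X.mulVec y) ≤ Real.sqrt n * (K * (‖x - v‖ + ‖y - v‖)) := by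
      rw [← mulVec_sub]
      refine (en_le_norm _).trans ?_
      gcongr
      refine (hb _).trans ?_
      gcongr
      have := norm_sub_le (x - v) (y - v)
      rwa [sub_sub_sub_cancel_right] at this
    calc _ ≤ Real.exp (-(qf Q (y - v)) / 2) * (Real.sqrt n * (K * (‖x - v‖ + ‖y - v‖))) :=
          mul_le_mul (post_le X Y v y) e1 (en_nonneg _) (Real.exp_pos _).le
      _ = _ := by ring

theorem post_integral_pos (hQ : Q.PosDef) : 0 < ∫ β, postUnnorm X Y v Q β := by
  rw [integral_pos_iff_support_of_nonneg (fun β => (post_pos X Y v β).le) (post_int X Y v hQ)]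
  have : Function.support (postUnnorm X Y v Q) = Set.univ := by
    ext β; simp [(post_pos X Y v β).ne']
  rw [this]
  exact Measure.measure_univ_pos.2 (NeZero.ne _)

theorem rho_bound (hQ : Q.PosDef) {c : ℝ} (hc : 0 < c)
    (hl : ∀ a, dotProduct a ((X * Q⁻¹ * Xᵀ).mulVec a) ≤ c * normSq a) :
    rhoStar X Y v Q ≤ c / (1 + c) := by
  obtain ⟨C, hC, hL⟩ := iter_lip X Y v hQ hc hl
  have hr0 : 0 < c / (1 + c) := by positivity
  have hr1 : c / (1 + c) ≤ 1 := by rw [div_le_one (by positivity)]; linarith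
  have hpos := post_integral_pos X Y v hQ
  have g0 : ∀ x, 0 ≤ postDen X Y v Q x := fun x => div_nonneg (post_pos X Y v x).le hpos.le
  have hD : ∀ x, Integrable fun y => postDen X Y v Q y * en (X.mulVec x - X.mulVec y) := fun x => by
    have := (post_int1 X Y v hQ x).div_const (∫ β, postUnnorm X Y v Q β)
    refine this.congr (ae_of_all _ fun y => ?_)
    simp only [postDen]; ring
  unfold rhoStar
  apply csInf_le ⟨0, fun r hr => hr.1.1⟩
  refine ⟨⟨hr0.le, hr1⟩, fun β => (∫ y, postDen X Y v Q y * en (X.mulVec β - X.mulVec y)) *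
    (C / (c / (1 + c))), fun β => ?_, fun β m => ?_⟩
  · have : 0 ≤ ∫ y, postDen X Y v Q y * en (X.mulVec β - X.mulVec y) :=
      integral_nonneg fun y => mul_nonneg (g0 y) (en_nonneg _)
    positivity
  · refine (generic_bound (kAC_markov X Y v hQ) (g := postDen X Y v Q) ?_ ?_ g0 ?_ ?_
      (fun x y => en (X.mulVec x - X.mulVec y)) hD m _ (hL m) β).trans (le_of_eq ?_)
    · exact (post_cont X Y v).measurable.div_const _
    · exact (post_int X Y v hQ).div_const _
    · simp only [postDen]
      rw [integral_div, div_self hpos.ne']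
    · intro x y
      simp only [postDen]
      rw [div_mul_eq_mul_div, div_mul_eq_mul_div, rev X Y v hQ]
    · rw [pow_succ]; field_simp

end main

/-- in the large p, small n regime, under (B1) (full row rank) and
(B2) (uniform bound on λ_max(X Q⁻¹ Xᵀ)), the geometric convergence rates of
Albert and Chib's chains are uniformly bounded away from 1. -/
theorem convergence_rate_stable_large_p
    (n : ℕ) (hn : 1 ≤ n) (Y : Fin n → Bool)
    (vs : (p : ℕ) → Fin p → ℝ)
    (Qs : (p : ℕ) → Matrix (Fin p) (Fin p) ℝ)
    (XX : (p : ℕ) → Matrix (Fin n) (Fin p) ℝ)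
    (hQpd : ∀ p, 1 ≤ p → (Qs p).PosDef)
    -- (B1)
    (hrank : ∀ p, 1 ≤ p → (XX p).rank = n)
    -- (B2)
    (hB2 : ∃ c : ℝ, ∀ p, 1 ≤ p → lmax (XX p * (Qs p)⁻¹ * (XX p)ᵀ) < c) :
    ∃ ρ : ℝ, ρ < 1 ∧ ∀ p, 1 ≤ p → rhoStar (XX p) Y (vs p) (Qs p) ≤ ρ := by
  obtain ⟨c, hc⟩ := hB2
  have h0 : 0 < max c 1 := lt_max_of_lt_right one_pos
  refine ⟨max c 1 / (1 + max c 1), by rw [div_lt_one (by positivity)]; linarith, fun p hp => ?_⟩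
  exact rho_bound (XX p) Y (vs p) (hQpd p hp) h0
    (lmax_bound (lt_of_lt_of_le (hc p hp) (le_max_left _ _)))
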